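/- Fix an integer k ≥ 2 and δ ∈ (0, 1/2). In the random k-out digraph 𝒟_{n,k}, with probability tending to 1 as n → ∞: the giant 𝒢 satisfies | |𝒢| − ν_k n | ≤ n^{1/2+δ}, and every vertex of [n] reaches some vertex of 𝒢. -/

import Mathlib

open scoped Classical
open Filter MeasureTheory

/-- Probability of an event under the uniform random `k`-out digraph model `𝒟_{n,k}`:
a uniformly random function `f : [n] × [k] → [n]`. -/
noncomputable def prob (n k : ℕ) (P : (Fin n × Fin k → Fin n) → Prop) : ℝ :=
  ((Finset.univ.filter P).card : ℝ) / (Fintype.card (Fin n × Fin k → Fin n) : ℝ)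

/-- One arc step: there is a labeled arc from `u` to `v`. -/
def Step {n k : ℕ} (f : Fin n × Fin k → Fin n) (u v : Fin n) : Prop :=
  ∃ i : Fin k, f (u, i) = v

/-- `u` reaches `v` by following finitely many arcs. -/
def Reaches {n k : ℕ} (f : Fin n × Fin k → Fin n) : Fin n → Fin n → Prop :=
  Relation.ReflTransGen (Step f)

/-- A set of vertices is closed if no arc leaves it. -/
def IsClosedSet {n k : ℕ} (f : Fin n × Fin k → Fin n) (S : Set (Fin n)) : Prop :=
  ∀ v ∈ S, ∀ i : Fin k, f (v, i) ∈ S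

/-- A set of vertices is strongly connected if it is nonempty and
any two of its vertices reach each other. -/
def IsStrConn {n k : ℕ} (f : Fin n × Fin k → Fin n) (S : Set (Fin n)) : Prop :=
  S.Nonempty ∧ ∀ u ∈ S, ∀ v ∈ S, Reaches f u v

/-- `G` is the giant: a closed strongly connected set of maximum size,
ties broken by choosing the one containing the smallest vertex label. -/
def IsGiant {n k : ℕ} (f : Fin n × Fin k → Fin n) (G : Set (Fin n)) : Prop :=
  IsClosedSet f G ∧ IsStrConn f G ∧
    (∀ S : Set (Fin n), IsClosedSet f S → IsStrConn f S → S.ncard ≤ G.ncard) ∧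
    (∀ S : Set (Fin n), IsClosedSet f S → IsStrConn f S → S.ncard = G.ncard →
      ∃ v ∈ G, ∀ u ∈ S, v ≤ u)

open Finset in
/-- The number of surjections is bounded by a coefficient of the generating function
`(e ^ t - 1) ^ |β|`. -/
theorem card_surjective_mul_pow_le {t : ℝ} (ht : 0 < t) (β : Type) [Fintype β] :
    ∀ (α : Type) [Fintype α],
      (Nat.card {g : α → β // Function.Surjective g} : ℝ) * t ^ Fintype.card α ≤
        (Fintype.card α).factorial * (Real.exp t - 1) ^ Fintype.card β := by
  have hexp : 0 ≤ Real.exp t - 1 := by linarith [Real.add_one_le_exp t]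
  refine Fintype.induction_empty_option (P := fun β _ => ∀ (α : Type) [Fintype α],
      (Nat.card {g : α → β // Function.Surjective g} : ℝ) * t ^ Fintype.card α ≤
        (Fintype.card α).factorial * (Real.exp t - 1) ^ Fintype.card β) ?_ ?_ ?_ β
  · intro β γ _ e ih α _
    let _ := Fintype.ofEquiv γ e.symm
    have h1 : Nat.card {g : α → β // Function.Surjective g} =
        Nat.card {g : α → γ // Function.Surjective g} := by
      refine Nat.card_congr ((Equiv.arrowCongr (Equiv.refl α) e).subtypeEquiv fun g => ?_)
      change _ ↔ Function.Surjective (e ∘ g ∘ id)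
      rw [Function.comp_id, e.comp_surjective]
    have h2 := Fintype.card_congr e
    have := ih α
    rw [h1] at this
    rw [← h2]
    convert this
  · intro α _
    cases isEmpty_or_nonempty α
    · have : Nat.card {g : α → PEmpty.{1} // Function.Surjective g} ≤ 1 :=
        Finite.card_le_one_iff_subsingleton.2 inferInstance
      simpa using this
    · have : IsEmpty {g : α → PEmpty.{1} // Function.Surjective g} :=
        ⟨fun g => (g.1 (Classical.arbitrary α)).elim⟩
      rw [Nat.card_of_isEmpty, Nat.cast_zero, zero_mul]
      positivity
  · intro β _ ih α _
    let F : {g : α → Option β // Function.Surjective g} →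
        Σ A : {A : Finset α // A ∈ univ.powerset.erase (∅ : Finset α)},
          {h : {a // a ∉ A.1} → β // Function.Surjective h} := fun g =>
      ⟨⟨univ.filter fun a => g.1 a = none, by
        obtain ⟨a, ha⟩ := g.2 none
        simp only [mem_erase, ne_eq, mem_powerset, subset_univ, and_true]
        exact Finset.Nonempty.ne_empty ⟨a, by simpa using ha⟩⟩,
       ⟨fun a => (g.1 a.1).get (Option.isSome_iff_ne_none.2 (by simpa using a.2)), fun b => by
        obtain ⟨a, ha⟩ := g.2 (some b)
        exact ⟨⟨a, by simp [ha]⟩, by simp [ha]⟩⟩⟩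
    have hF : Function.Injective F := by
      intro g g' h
      have key : ∀ g : {g : α → Option β // Function.Surjective g}, ∀ a,
          g.1 a = if h : a ∈ (F g).1.1 then none else some ((F g).2.1 ⟨a, h⟩) := by
        intro g a
        by_cases h : g.1 a = none
        · simp [F, h]
        · simp [F, h]
      ext1
      funext a
      rw [key g a, key g' a, h]
    have hcard := Nat.card_le_card_of_injective F hF
    rw [Nat.card_sigma] at hcard
    have hcard' : (Nat.card {g : α → Option β // Function.Surjective g} : ℝ) ≤
        ∑ A ∈ univ.powerset.erase (∅ : Finset α),
          (Nat.card {h : {a // a ∉ A} → β // Function.Surjective h} : ℝ) := by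
      rw [← Finset.sum_coe_sort]
      exact_mod_cast hcard
    set m := Fintype.card α with hm
    have hterm : ∀ A : Finset α,
        (Nat.card {h : {a // a ∉ A} → β // Function.Surjective h} : ℝ) * t ^ m ≤
          (fun j : ℕ => ((m - j).factorial : ℝ) * t ^ j) #A *
            (Real.exp t - 1) ^ Fintype.card β := by
      intro A
      have hA : Fintype.card {a // a ∉ A} = m - #A := by
        rw [Fintype.card_subtype_compl]; simp [hm]
      have h := ih {a // a ∉ A}
      rw [hA] at h
      have hle : #A ≤ m := card_le_univ A
      calc _ = (Nat.card {h : {a // a ∉ A} → β // Function.Surjective h} : ℝ) *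
            t ^ (m - #A) * t ^ #A := by rw [mul_assoc, ← pow_add, Nat.sub_add_cancel hle]
        _ ≤ _ := by
          refine (mul_le_mul_of_nonneg_right h (pow_nonneg ht.le #A)).trans (le_of_eq ?_)
          simp only
          ring
    have hsum : ∑ A ∈ univ.powerset.erase (∅ : Finset α),
        (fun j : ℕ => ((m - j).factorial : ℝ) * t ^ j) #A ≤ m.factorial * (Real.exp t - 1) := by
      rw [Finset.sum_erase_eq_sub (by simp), sum_powerset_apply_card
        (fun j : ℕ => ((m - j).factorial : ℝ) * t ^ j)]
      have : ∀ j ∈ range (#(univ : Finset α) + 1), (#(univ : Finset α)).choose j •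
          (((m - j).factorial : ℝ) * t ^ j) = m.factorial * (t ^ j / j.factorial) := by
        intro j hj
        have hj' : j ≤ m := by simpa [hm, Nat.lt_succ_iff] using hj
        rw [card_univ, ← hm, nsmul_eq_mul, ← Nat.choose_mul_factorial_mul_factorial hj']
        push_cast
        field_simp
      rw [sum_congr rfl this, ← mul_sum]
      simp only [card_empty, Nat.sub_zero, pow_zero, mul_one]
      rw [mul_sub, mul_one]
      gcongr
      exact Real.sum_le_exp_of_nonneg ht.le _
    calc _ ≤ (∑ A ∈ univ.powerset.erase (∅ : Finset α),
          (Nat.card {h : {a // a ∉ A} → β // Function.Surjective h} : ℝ)) * t ^ m := by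
          gcongr
      _ ≤ ∑ A ∈ univ.powerset.erase (∅ : Finset α),
          (fun j : ℕ => ((m - j).factorial : ℝ) * t ^ j) #A *
            (Real.exp t - 1) ^ Fintype.card β := by
          rw [sum_mul]
          exact sum_le_sum fun A _ => hterm A
      _ ≤ _ := by
          rw [← sum_mul, Fintype.card_option, pow_succ', ← mul_assoc]
          gcongr

/-- `S` is closed and every vertex of `S` receives an arc from `S`. -/
def IsSelfCovering {n k : ℕ} (f : Fin n × Fin k → Fin n) (S : Finset (Fin n)) : Prop :=
  (∀ v ∈ S, ∀ i, f (v, i) ∈ S) ∧ ∀ u ∈ S, ∃ v ∈ S, ∃ i, f (v, i) = u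

theorem Reaches.mem_of_isClosedSet {n k : ℕ} {f : Fin n × Fin k → Fin n} {S : Set (Fin n)}
    (hS : IsClosedSet f S) {u v : Fin n} (h : Reaches f u v) (hu : u ∈ S) : v ∈ S := by
  induction h with
  | refl => exact hu
  | tail _ hst ih =>
    obtain ⟨i, rfl⟩ := hst
    exact hS _ ih i

theorem isSelfCovering_of_isClosedSet {n k : ℕ} (hk : 0 < k) {f : Fin n × Fin k → Fin n}
    {S : Finset (Fin n)} (hS : IsClosedSet f (S : Set (Fin n)))
    (hS' : IsStrConn f (S : Set (Fin n))) : IsSelfCovering f S := by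
  refine ⟨fun v hv i => by simpa using hS v (by simpa using hv) i, fun u hu => ?_⟩
  have hw := hS u (by simpa using hu) ⟨0, hk⟩
  have hreach := hS'.2 _ hw u (by simpa using hu)
  rcases Relation.ReflTransGen.cases_tail hreach with h | ⟨y, hy, i, hi⟩
  · exact ⟨u, hu, ⟨0, hk⟩, h.symm⟩
  · exact ⟨y, by simpa using Reaches.mem_of_isClosedSet hS hy hw, i, hi⟩

/-- Every vertex of a finite digraph reaches a closed strongly connected set. -/
theorem exists_isClosedSet_isStrConn_reaches {n k : ℕ} (f : Fin n × Fin k → Fin n) (v : Fin n) :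
    ∃ S : Set (Fin n), IsClosedSet f S ∧ IsStrConn f S ∧ ∃ u ∈ S, Reaches f v u := by
  obtain ⟨u, hu, hmin⟩ := Set.exists_min_image {u | Reaches f v u}
    (fun u => {w | Reaches f u w}.ncard) (Set.toFinite _) ⟨v, Relation.ReflTransGen.refl⟩
  have hback : ∀ w, Reaches f u w → Reaches f w u := by
    intro w hw
    have hsub : {x | Reaches f w x} ⊆ {x | Reaches f u x} :=
      fun x hx => Relation.ReflTransGen.trans hw hx
    have := Set.eq_of_subset_of_ncard_le hsub (hmin w (Relation.ReflTransGen.trans hu hw))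
    have hmem : u ∈ {x | Reaches f u x} := Relation.ReflTransGen.refl
    rw [← this] at hmem
    exact hmem
  refine ⟨{w | Reaches f u w}, fun w hw i => Relation.ReflTransGen.tail hw ⟨i, rfl⟩,
    ⟨⟨u, Relation.ReflTransGen.refl⟩, fun x hx y hy => ?_⟩, u, Relation.ReflTransGen.refl, hu⟩
  exact Relation.ReflTransGen.trans (hback x hx) hy

theorem IsClosedSet.subset_of_isStrConn {n k : ℕ} {f : Fin n × Fin k → Fin n} {S T : Set (Fin n)}
    (hT : IsClosedSet f T) (hS : IsStrConn f S) (h : (S ∩ T).Nonempty) : S ⊆ T := by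
  obtain ⟨x, hxS, hxT⟩ := h
  exact fun y hy => Reaches.mem_of_isClosedSet hT (hS.2 x hxS y hy) hxT

/-- If all closed strongly connected sets contain more than half of the vertices, then there is
only one of them: it is the giant, and all vertices reach it. -/
theorem exists_isGiant_of_forall_lt_ncard {n k : ℕ} (hn : 0 < n) {f : Fin n × Fin k → Fin n}
    (h : ∀ S : Set (Fin n), IsClosedSet f S → IsStrConn f S → n < 2 * S.ncard) :
    ∃ G : Set (Fin n), IsGiant f G ∧ ∀ v : Fin n, ∃ u ∈ G, Reaches f v u := by
  obtain ⟨G, hGc, hGs, -⟩ := exists_isClosedSet_isStrConn_reaches f ⟨0, hn⟩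
  have huniq : ∀ S : Set (Fin n), IsClosedSet f S → IsStrConn f S → S = G := by
    intro S hSc hSs
    have hne : (S ∩ G).Nonempty := by
      by_contra hempty
      have hdisj : Disjoint S G :=
        Set.disjoint_iff_inter_eq_empty.2 (Set.not_nonempty_iff_eq_empty.1 hempty)
      have h1 := Set.ncard_union_eq hdisj
      have h2 : (S ∪ G).ncard ≤ n := by simpa using Set.ncard_le_card (S ∪ G)
      have h3 := h S hSc hSs
      have h4 := h G hGc hGs
      omega
    exact (hGc.subset_of_isStrConn hSs hne).antisymm
      (hSc.subset_of_isStrConn hGs (Set.inter_comm S G ▸ hne))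
  refine ⟨G, ⟨hGc, hGs, fun S h1 h2 => (huniq S h1 h2 ▸ le_rfl), fun S h1 h2 _ => ?_⟩, fun v => ?_⟩
  · obtain ⟨v, hv, hmin⟩ := Set.exists_min_image G id (Set.toFinite _) hGs.1
    exact ⟨v, hv, fun u hu => hmin u (huniq S h1 h2 ▸ hu)⟩
  · obtain ⟨S, h1, h2, u, hu, hvu⟩ := exists_isClosedSet_isStrConn_reaches f v
    exact ⟨u, huniq S h1 h2 ▸ hu, hvu⟩

theorem card_isSelfCovering_le {n k : ℕ} (S : Finset (Fin n)) :
    (Finset.univ.filter fun f : Fin n × Fin k → Fin n => IsSelfCovering f S).card ≤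
      Nat.card {g : S × Fin k → S // Function.Surjective g} * n ^ ((n - S.card) * k) := by
  let F : {f : Fin n × Fin k → Fin n // IsSelfCovering f S} →
      {g : S × Fin k → S // Function.Surjective g} × ({v // v ∉ S} × Fin k → Fin n) := fun f =>
    ⟨⟨fun p => ⟨f.1 (p.1.1, p.2), f.2.1 _ p.1.2 _⟩, fun u => by
      obtain ⟨v, hv, i, hi⟩ := f.2.2 u.1 u.2
      exact ⟨(⟨v, hv⟩, i), Subtype.ext hi⟩⟩, fun p => f.1 (p.1.1, p.2)⟩
  have hF : Function.Injective F := by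
    intro f g h
    have key : ∀ f : {f : Fin n × Fin k → Fin n // IsSelfCovering f S}, ∀ v i,
        f.1 (v, i) = if h : v ∈ S then ((F f).1.1 (⟨v, h⟩, i)).1 else (F f).2 (⟨v, h⟩, i) := by
      intro f v i
      by_cases h : v ∈ S <;> simp [F, h]
    ext1
    funext ⟨v, i⟩
    rw [key f v i, key g v i, h]
  have h := Nat.card_le_card_of_injective F hF
  rw [Nat.card_prod, Nat.card_eq_fintype_card, Fintype.card_subtype] at h
  refine h.trans (le_of_eq ?_)
  congr 1
  rw [Nat.card_eq_fintype_card, Fintype.card_fun, Fintype.card_prod, Fintype.card_subtype_compl]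
  simp

theorem concaveOn_log_one_sub_add_quadratic (b : ℝ) :
    ConcaveOn ℝ (Set.Ico 0 1) fun x => Real.log (1 - x) + b * x + x ^ 2 / 2 := by
  have hd : ∀ x ∈ Set.Ioo (0 : ℝ) 1, HasDerivAt
      (fun x => Real.log (1 - x) + b * x + x ^ 2 / 2) (-1 / (1 - x) + b + x) x := by
    intro x hx
    have h1 : HasDerivAt (fun x : ℝ => Real.log (1 - x)) (-1 / (1 - x)) x :=
      ((hasDerivAt_id x).const_sub 1).log (sub_pos.2 hx.2).ne'
    have h2 := (h1.add ((hasDerivAt_id x).const_mul b)).add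
      (((hasDerivAt_id x).pow 2).div_const 2)
    convert! h2 using 1
    simp
  refine AntitoneOn.concaveOn_of_deriv (convex_Ico 0 1) ?_ ?_ ?_
  · intro x hx
    have : (1 : ℝ) - x ≠ 0 := (sub_pos.2 hx.2).ne'
    exact ContinuousAt.continuousWithinAt (by fun_prop (disch := assumption))
  · rw [interior_Ico]
    exact fun x hx => (hd x hx).differentiableAt.differentiableWithinAt
  · rw [interior_Ico]
    intro x hx y hy hxy
    rw [(hd x hx).deriv, (hd y hy).deriv]
    have hx' : 0 < 1 - x := sub_pos.2 hx.2
    have hy' : 0 < 1 - y := sub_pos.2 hy.2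
    have h : 1 / (1 - y) - 1 / (1 - x) - (y - x) =
        (y - x) * (1 - (1 - x) * (1 - y)) / ((1 - x) * (1 - y)) := by
      field_simp
      ring
    have h' : 0 ≤ (y - x) * (1 - (1 - x) * (1 - y)) / ((1 - x) * (1 - y)) := by
      refine div_nonneg (mul_nonneg (sub_nonneg.2 hxy) ?_) (by positivity)
      nlinarith [hx.1, hy.1, mul_pos hx' hy.1]
    simp only [neg_div]
    linarith

section Rate

variable {a b : ℝ}

theorem mul_sub_div_two_le_log_one_sub_add (ha0 : 0 < a) (ha1 : a < 1)
    (hab : Real.log (1 - a) = -(b * a)) {x : ℝ} (hx0 : 0 ≤ x) (hxa : x ≤ a) :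
    x * (a - x) / 2 ≤ Real.log (1 - x) + b * x := by
  have h := (concaveOn_log_one_sub_add_quadratic (b - a / 2)).2
    (show a ∈ Set.Ico 0 1 from ⟨ha0.le, ha1⟩)
    (show (0 : ℝ) ∈ Set.Ico 0 1 from ⟨le_rfl, one_pos⟩) (show 0 ≤ x / a by positivity)
    (show 0 ≤ 1 - x / a by rw [sub_nonneg, div_le_one ha0]; exact hxa) (by ring)
  simp only [smul_eq_mul, mul_zero, add_zero, sub_zero, Real.log_one, hab,
    div_mul_cancel₀ x ha0.ne'] at h
  ring_nf at h ⊢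
  linarith

theorem log_one_sub_add_le_mul_sub_div_two (ha0 : 0 < a)
    (hab : Real.log (1 - a) = -(b * a)) {x : ℝ} (hax : a ≤ x) (hx1 : x < 1) :
    Real.log (1 - x) + b * x ≤ x * (a - x) / 2 := by
  have hx0 : 0 < x := ha0.trans_le hax
  have h := (concaveOn_log_one_sub_add_quadratic (b - a / 2)).2
    (show x ∈ Set.Ico 0 1 from ⟨hx0.le, hx1⟩)
    (show (0 : ℝ) ∈ Set.Ico 0 1 from ⟨le_rfl, one_pos⟩) (show 0 ≤ a / x by positivity)
    (show 0 ≤ 1 - a / x by rw [sub_nonneg, div_le_one hx0]; exact hax) (by ring)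
  simp only [smul_eq_mul, mul_zero, add_zero, sub_zero, Real.log_one, hab,
    div_mul_cancel₀ a hx0.ne'] at h
  have h2 : a / x * (Real.log (1 - x) + (b - a / 2) * x + x ^ 2 / 2) ≤ 0 := by
    ring_nf at h ⊢
    linarith
  have h3 := nonpos_of_mul_nonpos_right h2 (by positivity)
  linarith

/-- The exponential rate, per vertex of the set, of the expected number of self-covering sets with
`x * n` vertices is at most `- (x - a) ^ 2 / 4`. -/
theorem rate_le (ha0 : 0 < a) (ha1 : a < 1) (hab : Real.log (1 - a) = -(b * a)) {x : ℝ}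
    (hx0 : 0 < x) (hx1 : x ≤ 1) :
    (b - 1) * Real.log (x / a) - b + b * a - (1 - x) * Real.log (1 - x) / x ≤
      -((x - a) ^ 2 / 4) := by
  set ψ : ℝ → ℝ := fun x => (b - 1) * Real.log (x / a) - b + b * a -
    (1 - x) * Real.log (1 - x) / x + (x - a) ^ 2 / 4 with hψ
  have hψa : ψ a = 0 := by
    simp only [hψ, hab, div_self ha0.ne', Real.log_one]
    field_simp
    ring
  have hd : ∀ x ∈ Set.Ioo (0 : ℝ) 1,
      HasDerivAt ψ ((Real.log (1 - x) + b * x) / x ^ 2 + (x - a) / 2) x := by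
    intro x hx
    have hx' : 1 - x ≠ 0 := (sub_pos.2 hx.2).ne'
    have hxn : x ≠ 0 := hx.1.ne'
    have hsub := (hasDerivAt_id x).const_sub 1
    have h1 : HasDerivAt (fun x : ℝ => (1 - x) * Real.log (1 - x)) _ x :=
      hsub.mul (hsub.log hx')
    have h2 : HasDerivAt (fun x : ℝ => Real.log (x / a)) _ x :=
      ((hasDerivAt_id x).div_const a).log (div_pos hx.1 ha0).ne'
    have h3 := ((((h2.const_mul (b - 1)).sub_const b).add_const (b * a)).sub
      (h1.div (hasDerivAt_id x) hxn)).add ((((hasDerivAt_id x).sub_const a).pow 2).div_const 4)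
    convert! h3 using 1
    simp
    field_simp
    ring
  have hcont : ContinuousOn ψ (Set.Ioc 0 1) := by
    have h1 : Continuous fun x : ℝ => (1 - x) * Real.log (1 - x) :=
      Real.continuous_mul_log.comp (continuous_const.sub continuous_id)
    intro x hx
    have hxn : x ≠ 0 := hx.1.ne'
    have hxa : x / a ≠ 0 := (div_pos hx.1 ha0).ne'
    have h2 := (h1.continuousAt (x := x)).div continuousAt_id hxn
    refine ContinuousAt.continuousWithinAt ?_
    simp only [hψ]
    refine (ContinuousAt.sub ?_ h2).add ?_ <;> fun_prop (disch := assumption)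
  suffices h : ψ x ≤ ψ a by
    rw [hψa] at h
    simp only [hψ] at h
    linarith
  rcases le_total x a with hxa | hax
  · have hsub : Set.Icc x a ⊆ Set.Ioc 0 1 := fun y hy => ⟨hx0.trans_le hy.1, hy.2.trans ha1.le⟩
    have hsub' : Set.Ioo x a ⊆ Set.Ioo 0 1 := fun y hy => ⟨hx0.trans hy.1, hy.2.trans ha1⟩
    refine monotoneOn_of_deriv_nonneg (convex_Icc x a) (hcont.mono hsub) ?_ ?_
      (Set.left_mem_Icc.2 hxa) (Set.right_mem_Icc.2 hxa) hxa <;> rw [interior_Icc]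
    · exact fun y hy => (hd y (hsub' hy)).differentiableAt.differentiableWithinAt
    · intro y hy
      have hy' := hsub' hy
      rw [(hd y hy').deriv]
      have h := mul_sub_div_two_le_log_one_sub_add ha0 ha1 hab hy'.1.le hy.2.le
      have h2 : (a - y) / 2 ≤ (Real.log (1 - y) + b * y) / y ^ 2 := by
        rw [le_div_iff₀ (pow_pos hy'.1 2)]
        nlinarith [mul_nonneg (mul_nonneg hy'.1.le (sub_nonneg.2 hy.2.le)) (sub_nonneg.2 hy'.2.le)]
      linarith
  · have hsub : Set.Icc a x ⊆ Set.Ioc 0 1 := fun y hy => ⟨ha0.trans_le hy.1, hy.2.trans hx1⟩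
    have hsub' : Set.Ioo a x ⊆ Set.Ioo 0 1 := fun y hy => ⟨ha0.trans hy.1, hy.2.trans_le hx1⟩
    refine antitoneOn_of_deriv_nonpos (convex_Icc a x) (hcont.mono hsub) ?_ ?_
      (Set.left_mem_Icc.2 hax) (Set.right_mem_Icc.2 hax) hax <;> rw [interior_Icc]
    · exact fun y hy => (hd y (hsub' hy)).differentiableAt.differentiableWithinAt
    · intro y hy
      have hy' := hsub' hy
      rw [(hd y hy').deriv]
      have h := log_one_sub_add_le_mul_sub_div_two ha0 hab hy.1.le hy'.2
      have h2 : (Real.log (1 - y) + b * y) / y ^ 2 ≤ (a - y) / 2 := by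
        rw [div_le_iff₀ (pow_pos hy'.1 2)]
        nlinarith [mul_nonneg (mul_nonneg hy'.1.le (sub_nonneg.2 hy.1.le)) (sub_nonneg.2 hy'.2.le)]
      linarith

end Rate

theorem factorial_le_mul_exp {m : ℕ} (hm : 0 < m) :
    (m.factorial : ℝ) ≤ Real.exp 1 * m * Real.exp (m * Real.log m - m) := by
  obtain ⟨j, rfl⟩ := Nat.exists_eq_succ_of_ne_zero hm.ne'
  have h : Stirling.stirlingSeq j.succ ≤ Stirling.stirlingSeq 1 :=
    Stirling.stirlingSeq'_antitone (Nat.zero_le j)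
  generalize j.succ = m at *
  have hm' : (1 : ℝ) ≤ m := by exact_mod_cast hm
  rw [Stirling.stirlingSeq_one, Stirling.stirlingSeq, div_le_iff₀ (by positivity)] at h
  have hsqrt : √(2 * m : ℝ) / √2 ≤ m := by
    rw [← Real.sqrt_div (by positivity), Real.sqrt_le_left (by positivity)]
    nlinarith
  have hexp : (m / Real.exp 1) ^ m = Real.exp (m * Real.log m - m) := by
    rw [Real.exp_sub, mul_comm, Real.exp_mul, Real.exp_log (by positivity), div_pow,
      Real.rpow_natCast, ← Real.exp_nat_mul, mul_one]
  rw [hexp] at h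
  calc (m.factorial : ℝ) ≤ _ := h
    _ = Real.exp 1 * (√(2 * m : ℝ) / √2) * Real.exp (m * Real.log m - m) := by ring
    _ ≤ _ := by gcongr

theorem choose_le_exp {n s : ℕ} (hs : 0 < s) (hsn : s ≤ n) :
    (n.choose s : ℝ) ≤
      Real.exp (-(s * Real.log (s / n)) - (n - s : ℝ) * Real.log (1 - s / n)) := by
  have hs' : (0 : ℝ) < s := by exact_mod_cast hs
  have hn' : (0 : ℝ) < n := by exact_mod_cast hs.trans_le hsn
  have hle : (s / n : ℝ) ≤ 1 := by
    rw [div_le_one hn']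
    exact_mod_cast hsn
  have h1 : (s / n : ℝ) ^ s * (1 - s / n) ^ (n - s) * n.choose s ≤ 1 := by
    calc _ ≤ ∑ m ∈ Finset.range (n + 1),
          (s / n : ℝ) ^ m * (1 - s / n) ^ (n - m) * n.choose m := by
          refine Finset.single_le_sum
            (f := fun m : ℕ => (s / n : ℝ) ^ m * (1 - s / n) ^ (n - m) * n.choose m)
            (fun m _ => ?_) (Finset.mem_range.2 (Nat.lt_succ_of_le hsn))
          have := sub_nonneg.2 hle
          positivity
      _ = 1 := by rw [← add_pow]; simp
  have h2 : (s / n : ℝ) ^ s = Real.exp (s * Real.log (s / n)) := by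
    rw [← Real.rpow_natCast, Real.rpow_def_of_pos (by positivity), mul_comm]
  have h3 : (1 - s / n : ℝ) ^ (n - s) = Real.exp ((n - s : ℝ) * Real.log (1 - s / n)) := by
    rcases hsn.eq_or_lt with rfl | hlt
    · simp
    · have : (0 : ℝ) < 1 - s / n := by
        rw [sub_pos, div_lt_one hn']
        exact_mod_cast hlt
      rw [← Real.rpow_natCast, Real.rpow_def_of_pos this, mul_comm, Nat.cast_sub hsn]
  rw [h2, h3, ← Real.exp_add] at h1
  rw [← neg_add', Real.exp_neg, ← one_div, le_div_iff₀ (Real.exp_pos _)]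
  linarith

/-- An upper bound for the expected number of self-covering sets with `s` vertices. -/
noncomputable def selfCoveringBound (k : ℕ) (τ : ℝ) (n s : ℕ) : ℝ :=
  n.choose s * ((k * s).factorial * (Real.exp τ - 1) ^ s / (τ * n) ^ (k * s))

section Bound

variable {k : ℕ} {τ : ℝ}

theorem selfCoveringBound_nonneg (hτ0 : 0 < τ) (n s : ℕ) : 0 ≤ selfCoveringBound k τ n s := by
  have : 0 ≤ Real.exp τ - 1 := by linarith [Real.add_one_le_exp τ]
  unfold selfCoveringBound
  positivity

theorem selfCoveringBound_le_exp (hk : 0 < k) (hτ0 : 0 < τ)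
    (hτ : 1 - τ / k - Real.exp (-τ) = 0) {n s : ℕ} (hs : 0 < s) (hsn : s ≤ n) :
    selfCoveringBound k τ n s ≤
      Real.exp 1 * (k * s) * Real.exp (-(s * ((s / n - τ / k) ^ 2 / 4))) := by
  have hs' : (0 : ℝ) < s := by exact_mod_cast hs
  have hk' : (0 : ℝ) < k := by exact_mod_cast hk
  have hn' : (0 : ℝ) < n := by exact_mod_cast hs.trans_le hsn
  set a : ℝ := τ / k with ha
  have hτa : τ = k * a := by rw [ha]; field_simp
  have ha0 : 0 < a := by positivity
  have hexp : 1 - a = Real.exp (-τ) := by linarith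
  have ha1 : a < 1 := by linarith [Real.exp_pos (-τ)]
  have hab : Real.log (1 - a) = -(k * a) := by rw [hexp, Real.log_exp, hτa]
  have hx1 : (s / n : ℝ) ≤ 1 := by
    rw [div_le_one hn']
    exact_mod_cast hsn
  have hrate := rate_le ha0 ha1 hab (x := s / n) (by positivity) hx1
  have h1 : Real.exp τ - 1 = Real.exp (Real.log a + τ) := by
    rw [Real.exp_add, Real.exp_log ha0]
    have : a = 1 - Real.exp (-τ) := by linarith
    rw [this, sub_mul, ← Real.exp_add]
    simp
  have h2 : (Real.exp τ - 1) ^ s = Real.exp (s * (Real.log a + τ)) := by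
    rw [h1, ← Real.exp_nat_mul]
  have h3 : (τ * n) ^ (k * s) = Real.exp (k * s * Real.log (τ * n)) := by
    rw [← Real.rpow_natCast, Real.rpow_def_of_pos (by positivity), mul_comm]
    push_cast
    rfl
  have h4 := factorial_le_mul_exp (Nat.mul_pos hk hs)
  push_cast at h4
  unfold selfCoveringBound
  rw [h2, h3, mul_div_assoc, ← Real.exp_sub]
  calc _ ≤ Real.exp (-(s * Real.log (s / n)) - (n - s : ℝ) * Real.log (1 - s / n)) *
        (Real.exp 1 * (k * s) * Real.exp (k * s * Real.log (k * s) - k * s) *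
          Real.exp (s * (Real.log a + τ) - k * s * Real.log (τ * n))) := by
        gcongr
        exact choose_le_exp hs hsn
    _ = Real.exp 1 * (k * s) * Real.exp (s * ((k - 1) * Real.log (s / n / a) - k + k * a -
          (1 - s / n) * Real.log (1 - s / n) / (s / n))) := by
        rw [mul_assoc (Real.exp 1 * (k * s : ℝ)), ← Real.exp_add, mul_left_comm, ← Real.exp_add]
        congr 2
        have e1 : Real.log (s / n / a) = Real.log s - Real.log n - Real.log a := by
          rw [Real.log_div (by positivity) ha0.ne', Real.log_div hs'.ne' hn'.ne']
        have e2 : Real.log (k * s) = Real.log k + Real.log s := Real.log_mul hk'.ne' hs'.ne'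
        have e3 : Real.log (τ * n) = Real.log k + Real.log a + Real.log n := by
          rw [hτa, Real.log_mul (by positivity) hn'.ne', Real.log_mul hk'.ne' ha0.ne']
        have e4 : (s : ℝ) * ((1 - s / n) * Real.log (1 - s / n) / (s / n)) =
            (n - s) * Real.log (1 - s / n) := by field_simp
        rw [mul_sub (s : ℝ) _ (_ / _), e4, e1, e2, e3, Real.log_div hs'.ne' hn'.ne', hτa]
        ring
    _ ≤ _ := by
        rw [← mul_neg]
        gcongr

theorem tendsto_selfCoveringBound (hk : 2 ≤ k) (hτ0 : 0 < τ) {s : ℕ} (hs : 0 < s) :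
    Tendsto (fun n => selfCoveringBound k τ n s) atTop (nhds 0) := by
  have hexp : 0 ≤ Real.exp τ - 1 := by linarith [Real.add_one_le_exp τ]
  set C : ℝ := (k * s).factorial * (Real.exp τ - 1) ^ s / τ ^ (k * s) with hC
  have hlim : Tendsto (fun n : ℕ => C / n) atTop (nhds 0) :=
    tendsto_const_div_atTop_nhds_zero_nat C
  refine squeeze_zero' (Eventually.of_forall fun n => selfCoveringBound_nonneg hτ0 n s) ?_ hlim
  filter_upwards [eventually_ge_atTop 1] with n hn
  have hn' : (1 : ℝ) ≤ n := by exact_mod_cast hn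
  have hC0 : 0 ≤ C := by positivity
  calc selfCoveringBound k τ n s = n.choose s * (C / n ^ (k * s)) := by
        rw [selfCoveringBound, mul_pow, hC, div_div]
    _ ≤ n ^ s * (C / n ^ (s + 1)) := by
        gcongr
        · exact_mod_cast Nat.choose_le_pow n s
        · nlinarith
    _ = C / n := by
        rw [pow_succ]
        field_simp

theorem summable_mul_exp_neg_mul_rpow {c p : ℝ} (hc : 0 < c) (hp : 0 < p) :
    Summable fun s : ℕ => (s : ℝ) * Real.exp (-(c * (s : ℝ) ^ p)) := by
  have h := (isLittleO_exp_neg_mul_rpow_atTop hc (-(3 / p))).isBigO.comp_tendsto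
    ((tendsto_rpow_atTop hp).comp tendsto_natCast_atTop_atTop)
  have h2 := (Asymptotics.isBigO_refl (fun s : ℕ => (s : ℝ)) atTop).mul h
  refine summable_of_isBigO_nat (g := fun s : ℕ => (s : ℝ) ^ (-2 : ℝ))
    (Real.summable_nat_rpow.2 (by norm_num)) ?_
  refine (h2.congr' ?_ ?_)
  · exact Eventually.of_forall fun s => by simp
  · filter_upwards [eventually_gt_atTop 0] with s hs
    have hs' : (0 : ℝ) < s := by exact_mod_cast hs
    simp only [Function.comp]
    rw [← Real.rpow_mul hs'.le]
    nth_rewrite 1 [← Real.rpow_one (s : ℝ)]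
    rw [← Real.rpow_add hs']
    congr 1
    field_simp
    norm_num

/-- The sum of the bounds over all sizes outside the window tends to `0`. -/
theorem tendsto_sum_selfCoveringBound (hk : 2 ≤ k) (hτ0 : 0 < τ)
    (hτ : 1 - τ / k - Real.exp (-τ) = 0) {δ : ℝ} (hδ0 : 0 < δ) (hδ : δ < 1 / 2) :
    Tendsto (fun n : ℕ => ∑ s ∈ (Finset.Icc 1 n).filter
        (fun s : ℕ => (n : ℝ) ^ ((1 : ℝ) / 2 + δ) < |(s : ℝ) - τ / k * n|),
      selfCoveringBound k τ n s) atTop (nhds 0) := by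
  have hk' : (0 : ℝ) < k := by exact_mod_cast (by omega : 0 < k)
  set a : ℝ := τ / k with ha
  have ha0 : 0 < a := by positivity
  have ha1 : a < 1 := by linarith [Real.exp_pos (-τ)]
  set A : ℕ → Finset ℕ := fun n => (Finset.Icc 1 n).filter
        (fun s : ℕ => (n : ℝ) ^ ((1 : ℝ) / 2 + δ) < |(s : ℝ) - a * n|) with hA
  have hsum : ∀ n : ℕ, ∑ s ∈ A n, selfCoveringBound k τ n s =
      ∑' s : ℕ, (if s ∈ A n then selfCoveringBound k τ n s else 0) := by
    intro n
    rw [tsum_eq_sum (s := A n) (fun s hs => by simp [hs])]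
    exact Finset.sum_congr rfl fun s hs => by simp [hs]
  change Tendsto (fun n : ℕ => ∑ s ∈ A n, selfCoveringBound k τ n s) atTop (nhds 0)
  simp_rw [hsum]
  suffices h : Tendsto (fun n : ℕ =>
      ∑' s : ℕ, (if s ∈ A n then selfCoveringBound k τ n s else 0)) atTop
      (nhds (∑' _ : ℕ, (0 : ℝ))) by rwa [tsum_zero] at h
  refine tendsto_tsum_of_dominated_convergence
    (bound := fun s : ℕ => Real.exp 1 * k * ((s : ℝ) *
      Real.exp (-(a ^ 2 / 16 * (s : ℝ) ^ (2 * δ)))))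
    ((summable_mul_exp_neg_mul_rpow (by positivity) (by positivity)).mul_left _) ?_ ?_
  · intro s
    rcases Nat.eq_zero_or_pos s with rfl | hs
    · simp [hA]
    · refine squeeze_zero (fun n => ?_) (fun n => ?_) (tendsto_selfCoveringBound hk hτ0 hs)
      · split_ifs
        exacts [selfCoveringBound_nonneg hτ0 n s, le_rfl]
      · split_ifs
        exacts [le_rfl, selfCoveringBound_nonneg hτ0 n s]
  · refine Eventually.of_forall fun n s => ?_
    split_ifs with hs
    swap
    · rw [norm_zero]
      positivity
    rw [Real.norm_of_nonneg (selfCoveringBound_nonneg hτ0 n s)]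
    simp only [hA, Finset.mem_filter, Finset.mem_Icc] at hs
    obtain ⟨⟨hs1, hsn⟩, hwin⟩ := hs
    have hs' : (1 : ℝ) ≤ s := by exact_mod_cast hs1
    have hsn' : (s : ℝ) ≤ n := by exact_mod_cast hsn
    have hn' : (0 : ℝ) < n := by linarith
    refine (selfCoveringBound_le_exp (by omega) hτ0 hτ hs1 hsn).trans ?_
    rw [← ha, ← mul_assoc, ← mul_assoc]
    refine mul_le_mul_of_nonneg_left (Real.exp_le_exp.2 (neg_le_neg ?_)) (by positivity)
    rcases le_total (s / n : ℝ) (a / 2) with hx | hx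
    · have h1 : (s : ℝ) ^ (2 * δ) ≤ s := by
        conv_rhs => rw [← Real.rpow_one (s : ℝ)]
        exact Real.rpow_le_rpow_of_exponent_le hs' (by linarith)
      have h2 : a ^ 2 / 4 ≤ (s / n - a) ^ 2 := by nlinarith
      nlinarith [mul_le_mul_of_nonneg_left h2 (by linarith : (0 : ℝ) ≤ s),
        mul_le_mul_of_nonneg_left h1 (by positivity : (0 : ℝ) ≤ a ^ 2)]
    · have h1 : ((n : ℝ) ^ ((1 : ℝ) / 2 + δ)) ^ 2 ≤ (s - a * n) ^ 2 := by
        rw [← sq_abs (s - a * n : ℝ)]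
        gcongr
      have h2 : ((n : ℝ) ^ ((1 : ℝ) / 2 + δ)) ^ 2 = n * (n : ℝ) ^ (2 * δ) := by
        rw [← Real.rpow_natCast, ← Real.rpow_mul hn'.le, ← Real.rpow_one_add' hn'.le (by positivity)]
        congr 1
        push_cast
        ring
      have h3 : (s : ℝ) ^ (2 * δ) ≤ (n : ℝ) ^ (2 * δ) := by gcongr
      have h4 : (s : ℝ) * (s / n - a) ^ 2 = (s / n) * ((s - a * n) ^ 2 / n) := by field_simp
      have h5 : (n : ℝ) ^ (2 * δ) ≤ (s - a * n) ^ 2 / n := by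
        rw [le_div_iff₀ hn']
        linarith
      have h6 : a / 2 * (s : ℝ) ^ (2 * δ) ≤ s * (s / n - a) ^ 2 := by
        rw [h4]
        exact mul_le_mul hx (h3.trans h5) (by positivity) (by positivity)
      have h7 : 0 ≤ (s : ℝ) ^ (2 * δ) := by positivity
      nlinarith [mul_nonneg (mul_nonneg ha0.le (sub_nonneg.2 ha1.le)) h7, mul_nonneg ha0.le h7]

end Bound

theorem prob_le_sum {n k : ℕ} {ι : Type*} {P : (Fin n × Fin k → Fin n) → Prop} (T : Finset ι)
    (Q : ι → (Fin n × Fin k → Fin n) → Prop) (h : ∀ f, P f → ∃ i ∈ T, Q i f) :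
    prob n k P ≤ ∑ i ∈ T, prob n k (Q i) := by
  have hsub : Finset.univ.filter P ⊆ T.biUnion fun i => Finset.univ.filter (Q i) := by
    intro f hf
    simpa using h f (by simpa using hf)
  simp only [prob]
  rw [← Finset.sum_div]
  gcongr
  exact_mod_cast (Finset.card_le_card hsub).trans Finset.card_biUnion_le

theorem prob_isSelfCovering_le {n k : ℕ} (hn : 0 < n) {τ : ℝ} (hτ0 : 0 < τ)
    (S : Finset (Fin n)) :
    prob n k (fun f => IsSelfCovering f S) ≤
      (k * S.card).factorial * (Real.exp τ - 1) ^ S.card / (τ * n) ^ (k * S.card) := by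
  have hn' : (0 : ℝ) < n := by exact_mod_cast hn
  have hSn : S.card ≤ n := by simpa using S.card_le_univ
  have h1 : ((Finset.univ.filter fun f : Fin n × Fin k → Fin n => IsSelfCovering f S).card : ℝ) ≤
      Nat.card {g : S × Fin k → S // Function.Surjective g} * (n : ℝ) ^ ((n - S.card) * k) := by
    exact_mod_cast card_isSelfCovering_le S
  have h2 := card_surjective_mul_pow_le hτ0 S (S × Fin k)
  simp only [Fintype.card_prod, Fintype.card_coe, Fintype.card_fin] at h2
  rw [mul_comm S.card k] at h2
  have hpow : (n : ℝ) ^ (n * k) = n ^ ((n - S.card) * k) * n ^ (k * S.card) := by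
    rw [← pow_add, mul_comm k, ← add_mul, Nat.sub_add_cancel hSn]
  have htotal : (Fintype.card (Fin n × Fin k → Fin n) : ℝ) = n ^ (n * k) := by simp
  rw [prob, htotal, div_le_div_iff₀ (by positivity) (by positivity), mul_pow, hpow]
  calc _ ≤ Nat.card {g : S × Fin k → S // Function.Surjective g} *
        (n : ℝ) ^ ((n - S.card) * k) * (τ ^ (k * S.card) * n ^ (k * S.card)) := by gcongr
    _ = (Nat.card {g : S × Fin k → S // Function.Surjective g} * τ ^ (k * S.card)) *
        ((n : ℝ) ^ ((n - S.card) * k) * n ^ (k * S.card)) := by ring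
    _ ≤ _ := by gcongr

theorem prob_exists_isSelfCovering_le {n k : ℕ} (hn : 0 < n) {τ : ℝ} (hτ0 : 0 < τ)
    {A : Finset ℕ} (hA : A ⊆ Finset.range (n + 1)) :
    prob n k (fun f => ∃ S : Finset (Fin n), S.card ∈ A ∧ IsSelfCovering f S) ≤
      ∑ s ∈ A, selfCoveringBound k τ n s := by
  set g : ℕ → ℝ := fun s =>
    (k * s).factorial * (Real.exp τ - 1) ^ s / (τ * n) ^ (k * s) with hg
  calc _ ≤ ∑ S ∈ Finset.univ.filter fun S : Finset (Fin n) => S.card ∈ A,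
        prob n k (fun f => IsSelfCovering f S) :=
        prob_le_sum _ (fun S f => IsSelfCovering f S) fun f hf => by simpa using hf
    _ ≤ ∑ S ∈ Finset.univ.filter fun S : Finset (Fin n) => S.card ∈ A, g S.card :=
        Finset.sum_le_sum fun S _ => prob_isSelfCovering_le hn hτ0 S
    _ = ∑ S ∈ (Finset.univ : Finset (Fin n)).powerset,
          (fun s => if s ∈ A then g s else 0) S.card := by
        rw [Finset.sum_filter, Finset.powerset_univ]
    _ = ∑ s ∈ A, selfCoveringBound k τ n s := by
        rw [Finset.sum_powerset_apply_card (fun s => if s ∈ A then g s else 0), Finset.card_univ,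
          Fintype.card_fin, ← Finset.sum_subset hA fun s _ hs => by simp [hs]]
        exact Finset.sum_congr rfl fun s hs => by
          rw [if_pos hs, nsmul_eq_mul, selfCoveringBound]

theorem prob_le_one {n k : ℕ} (P : (Fin n × Fin k → Fin n) → Prop) : prob n k P ≤ 1 :=
  div_le_one_of_le₀ (by exact_mod_cast Finset.card_le_univ _) (by positivity)

theorem one_le_prob_add_prob {n k : ℕ} (hn : 0 < n) {P Q : (Fin n × Fin k → Fin n) → Prop}
    (h : ∀ f, P f ∨ Q f) : 1 ≤ prob n k P + prob n k Q := by
  have : Nonempty (Fin n × Fin k → Fin n) := ⟨fun _ => ⟨0, hn⟩⟩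
  have hpos : (0 : ℝ) < Fintype.card (Fin n × Fin k → Fin n) := by
    exact_mod_cast Fintype.card_pos
  rw [prob, prob, ← add_div, one_le_div hpos]
  have hunion : Finset.univ.filter P ∪ Finset.univ.filter Q = Finset.univ := by
    ext f
    simpa using h f
  have := Finset.card_union_le (Finset.univ.filter P) (Finset.univ.filter Q)
  rw [hunion, Finset.card_univ] at this
  exact_mod_cast this

theorem half_lt_of_one_sub_eq_exp {k : ℕ} (hk : 2 ≤ k) {τ : ℝ} (hτ0 : 0 < τ)
    (hτ : 1 - τ / k - Real.exp (-τ) = 0) : 1 / 2 < τ / k := by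
  have hk' : (2 : ℝ) ≤ k := by exact_mod_cast hk
  have hk0 : (0 : ℝ) < k := by linarith
  set a : ℝ := τ / k with ha
  have ha0 : 0 < a := by positivity
  have hτa : 2 * a ≤ τ := by
    rw [ha, ← mul_div_assoc, div_le_iff₀ hk0]
    nlinarith
  have hexp : Real.exp (-τ) = 1 - a := by linarith
  have h1 : τ + 1 < Real.exp τ := Real.add_one_lt_exp hτ0.ne'
  have h2 : Real.exp τ * (1 - a) = 1 := by rw [← hexp, ← Real.exp_add]; simp
  nlinarith [Real.exp_pos (-τ)]

theorem eventually_rpow_lt_mul {c p : ℝ} (hc : 0 < c) (hp : p < 1) :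
    ∀ᶠ n : ℕ in atTop, (n : ℝ) ^ p < c * n := by
  have h := (tendsto_rpow_neg_atTop (sub_pos.2 hp)).comp tendsto_natCast_atTop_atTop
  filter_upwards [h.eventually_lt_const hc, eventually_gt_atTop 0] with n hn hn0
  have hn' : (0 : ℝ) < n := by exact_mod_cast hn0
  have hpow : (n : ℝ) ^ p = (n : ℝ) ^ (-(1 - p)) * n := by
    rw [← Real.rpow_add_one hn'.ne']
    congr 1
    ring
  rw [hpow]
  gcongr
  exact hn

/-- Whp the giant has size within `n^{1/2+δ}` of `ν_k n` and is reachable from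
every vertex. -/
theorem giant_size_and_reachability (k : ℕ) (hk : 2 ≤ k) (δ : ℝ) (hδ0 : 0 < δ)
    (hδ : δ < 1 / 2) (τ : ℝ) (hτpos : 0 < τ) (hτ : 1 - τ / k - Real.exp (-τ) = 0) :
    Filter.Tendsto (fun n : ℕ =>
      prob n k (fun f => ∃ G : Set (Fin n), IsGiant f G ∧
        |(G.ncard : ℝ) - (τ / k) * n| ≤ (n : ℝ) ^ ((1 : ℝ) / 2 + δ) ∧
        ∀ v : Fin n, ∃ u ∈ G, Reaches f v u))
      Filter.atTop (nhds 1) := by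
  set a : ℝ := τ / k with ha
  have hlim := tendsto_sum_selfCoveringBound hk hτpos hτ hδ0 hδ
  have ha2 : 1 / 2 < a := half_lt_of_one_sub_eq_exp hk hτpos hτ
  have hlow : Tendsto (fun n : ℕ => 1 - ∑ s ∈ (Finset.Icc 1 n).filter
        (fun s : ℕ => (n : ℝ) ^ ((1 : ℝ) / 2 + δ) < |(s : ℝ) - a * n|),
      selfCoveringBound k τ n s) atTop (nhds 1) := by
    simpa using hlim.const_sub 1
  refine tendsto_of_tendsto_of_tendsto_of_le_of_le' hlow tendsto_const_nhds ?_
    (Eventually.of_forall fun n => prob_le_one _)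
  filter_upwards [eventually_gt_atTop 0, eventually_rpow_lt_mul (sub_pos.2 ha2)
    (show (1 : ℝ) / 2 + δ < 1 by linarith)] with n hn hsmall
  rw [sub_le_iff_le_add]
  have hA : (Finset.Icc 1 n).filter
      (fun s : ℕ => (n : ℝ) ^ ((1 : ℝ) / 2 + δ) < |(s : ℝ) - a * n|) ⊆ Finset.range (n + 1) := by
    intro s hs
    simp only [Finset.mem_filter, Finset.mem_Icc] at hs
    simp only [Finset.mem_range]
    omega
  refine (one_le_prob_add_prob hn fun f => ?_).trans
    (add_le_add_right (prob_exists_isSelfCovering_le (k := k) hn hτpos hA) _)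
  by_contra! hbad
  obtain ⟨hnot, hcov⟩ := hbad
  have hwin : ∀ S : Set (Fin n), IsClosedSet f S → IsStrConn f S →
      |(S.ncard : ℝ) - a * n| ≤ (n : ℝ) ^ ((1 : ℝ) / 2 + δ) := by
    intro S hc hs
    by_contra! hlt
    have hcard : S.toFinset.card = S.ncard := (Set.ncard_eq_toFinset_card' S).symm
    refine hcov S.toFinset ?_ (isSelfCovering_of_isClosedSet (by omega) (by simpa using hc)
      (by simpa using hs))
    have h1 : 1 ≤ S.ncard := (Set.ncard_pos).2 hs.1
    have h2 : S.ncard ≤ n := by simpa using Set.ncard_le_card S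
    simpa [hcard, h1, h2] using hlt
  obtain ⟨G, hG, hreach⟩ := exists_isGiant_of_forall_lt_ncard hn (f := f) fun S hc hs => by
    have h := (abs_le.1 (hwin S hc hs)).1
    have : (n : ℝ) < 2 * S.ncard := by linarith
    exact_mod_cast this
  obtain ⟨v, hv⟩ := hnot G hG (hwin G hG.1 hG.2.1)
  obtain ⟨u, hu, hvu⟩ := hreach v
  exact hv u hu hvu
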